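/- For every x ∈ K^×, setting y = x'/x ∈ K, the element λ( u(x)/v(x) − 1 ) − Σ_{i=1}^{p−1} v(t^i·y^{(i−1)}/i!)·(t^r·θ)^i of L lies in t^{pr}·R_L; here λ is evaluated in L, which is meaningful since u(x)/v(x) − 1 ∈ t^r·R_L. -/

import Mathlib

/-!
Setting: `p > 2` a prime, `k` a perfect field of characteristic `p`,
`K = k((t))` the field of formal Laurent series, `ord` the `t`-adic valuation
(with `ord 0 = +∞`, encoded below via the predicate `ordGe`),
`L = k(θ)((t))` with `k(θ) = RatFunc k`.
-/

noncomputable section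

namespace LFT

variable {F : Type*} [Field F]

/-- The formal derivative of a Laurent series: the coefficient of `t^j` in `lsDeriv x`
is `(j+1)` times the coefficient of `t^{j+1}` in `x`. -/
def lsDeriv (x : LaurentSeries F) : LaurentSeries F where
  coeff j := (j + 1) • x.coeff (j + 1)
  isPWO_support' := by
    have h : Function.support (fun j : ℤ => (j + 1) • x.coeff (j + 1)) ⊆
        (fun j : ℤ => j - 1) '' Function.support x.coeff := by
      intro j hj
      refine ⟨j + 1, ?_, by ring⟩
      intro h0
      simp [Function.mem_support, h0] at hj
    exact (x.isPWO_support'.image_of_monotone (fun a b hab => by omega)).mono h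

/-- The uniformizer `t` of `F((t))`. -/
def tt : LaurentSeries F := HahnSeries.single 1 1

/-- `ordGe x N` means `ord x ≥ N`, with the convention `ord 0 = +∞`. -/
def ordGe (x : LaurentSeries F) (N : ℤ) : Prop := x = 0 ∨ N ≤ x.order

/-- The element `θ` of `k(θ) ⊆ k(θ)((t))`. -/
def θθ (k : Type*) [Field k] : LaurentSeries (RatFunc k) := HahnSeries.single 0 RatFunc.X

/-- Membership in the level `N` of the Kato filtration `fil_N W_{m+1}(F((t)))`:
`p^{m-i}·ord(a_i) ≥ -N` for all `0 ≤ i ≤ m` (with `ord 0 = +∞`). -/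
def inFil (p : ℕ) {m : ℕ} (N : ℤ) (a : TruncatedWittVector p (m + 1) (LaurentSeries F)) : Prop :=
  ∀ i : Fin (m + 1), a.coeff i = 0 ∨ -N ≤ (p : ℤ) ^ (m - (i : ℕ)) * (a.coeff i).order

/-- `α(a) = Σ_{i=0}^m a_i^{p^{m-i}-1}·a_i'`, so that `F^m d(a) = α(a)·dt`. -/
def alphaW (p : ℕ) {m : ℕ} (a : TruncatedWittVector p (m + 1) (LaurentSeries F)) :
    LaurentSeries F :=
  ∑ i : Fin (m + 1), a.coeff i ^ (p ^ (m - (i : ℕ)) - 1) * lsDeriv (a.coeff i)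

/-- The componentwise map `W_{m+1}(f)` on truncated Witt vectors induced by `f`. -/
def mapTW (p : ℕ) {m : ℕ} {K L : Type*} (f : K → L)
    (a : TruncatedWittVector p (m + 1) K) : TruncatedWittVector p (m + 1) L :=
  TruncatedWittVector.mk p fun i => f (a.coeff i)

/-- `V^m(z) = (0, …, 0, z)` in `W_{m+1}(L)`. -/
def Vm (p : ℕ) {m : ℕ} {L : Type*} [Zero L] (z : L) : TruncatedWittVector p (m + 1) L :=
  TruncatedWittVector.mk p fun i => if (i : ℕ) = m then z else 0


/-- The shifted `p`-truncated logarithm `λ(Y) = Σ_{i=1}^{p−1} (−1)^{i+1}·Y^i/i`,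
evaluated in a field of characteristic `p` (where the coefficients are meaningful). -/
def lam (p : ℕ) {F : Type*} [Field F] (Y : LaurentSeries F) : LaurentSeries F :=
  ∑ i ∈ Finset.Icc 1 (p - 1),
    ((-1 : LaurentSeries F) ^ (i + 1) * (i : LaurentSeries F)⁻¹) * Y ^ i

section Algebra

open Polynomial

/-- Agreement of the coefficients below `m`. -/
def Cong {K : Type*} [Field K] (m : ℕ) (f g : K[X]) : Prop := ∀ i < m, f.coeff i = g.coeff i

/-- The truncated Taylor polynomial. -/
def TT {K : Type*} [Field K] (p : ℕ) (D : K → K) (x : K) : K[X] :=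
  ∑ i ∈ Finset.range p, C (D^[i] x / (Nat.factorial i : K)) * X ^ i

/-- Truncated logarithm on polynomials. -/
def lamP {K : Type*} [Field K] (p : ℕ) (z : K[X]) : K[X] :=
  ∑ i ∈ Finset.Icc 1 (p - 1), C ((-1) ^ (i + 1) * (i : K)⁻¹) * z ^ i

variable {K : Type*} [Field K]

theorem Cong.refl (m : ℕ) (f : K[X]) : Cong m f f := fun _ _ => rfl

theorem Cong.mul {m : ℕ} {f g f' g' : K[X]} (h : Cong m f f') (h' : Cong m g g') :
    Cong m (f * g) (f' * g') := by
  intro n hn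
  rw [coeff_mul, coeff_mul]
  refine Finset.sum_congr rfl fun ij hij => ?_
  have := Finset.HasAntidiagonal.mem_antidiagonal.1 hij
  rw [h _ (by omega), h' _ (by omega)]

theorem coeff_TT (p : ℕ) (D : K → K) (x : K) (n : ℕ) :
    (TT p D x).coeff n = if n < p then D^[n] x / (Nat.factorial n : K) else 0 := by
  simp [TT, coeff_C_mul, coeff_X_pow]

theorem TT_add (p : ℕ) (D : K → K) (hadd : ∀ x y, D (x + y) = D x + D y) (x y : K) :
    TT p D (x + y) = TT p D x + TT p D y := by
  have h : ∀ n, D^[n] (x + y) = D^[n] x + D^[n] y := by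
    intro n
    induction n with
    | zero => rfl
    | succ n ih => simp only [Function.iterate_succ_apply', ih, hadd]
  ext n
  rw [coeff_add]
  simp only [coeff_TT, h]
  split_ifs <;> simp [add_div]

theorem derivative_TT (p : ℕ) (hinv : ∀ n : ℕ, 0 < n → n < p → (n : K) ≠ 0) (D : K → K) (x : K) :
    Cong (p - 1) (derivative (TT p D x)) (TT p D (D x)) := by
  intro n hn
  have h1 : ((n + 1 : ℕ) : K) ≠ 0 := hinv _ (by omega) (by omega)
  rw [coeff_derivative, coeff_TT, coeff_TT, if_pos (by omega), if_pos (by omega),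
    Function.iterate_succ_apply, Nat.factorial_succ, Nat.cast_mul]
  rw [← Nat.cast_succ, div_mul_eq_mul_div, mul_comm, mul_div_mul_left _ _ h1]

theorem TT_mul (p : ℕ) (hinv : ∀ n : ℕ, 0 < n → n < p → (n : K) ≠ 0) (D : K → K)
    (hadd : ∀ x y, D (x + y) = D x + D y) (hmul : ∀ x y, D (x * y) = D x * y + x * D y)
    (x y : K) : Cong p (TT p D (x * y)) (TT p D x * TT p D y) := by
  intro n
  induction n generalizing x y with
  | zero =>
    intro h
    rw [mul_coeff_zero]
    simp [coeff_TT, h]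
  | succ n ih =>
    intro hn
    have h1 : ((n + 1 : ℕ) : K) ≠ 0 := hinv _ (by omega) (by omega)
    have hd := derivative_TT p hinv D
    refine mul_right_cancel₀ h1 ?_
    rw [Nat.cast_succ, ← coeff_derivative, ← coeff_derivative, hd _ n (by omega), hmul,
      TT_add p D hadd, coeff_add, ih _ _ (by omega), ih _ _ (by omega), derivative_mul, coeff_add]
    have e1 : Cong (p - 1) (derivative (TT p D x) * TT p D y) (TT p D (D x) * TT p D y) :=
      Cong.mul (hd x) (Cong.refl _ _)
    have e2 : Cong (p - 1) (TT p D x * derivative (TT p D y)) (TT p D x * TT p D (D y)) :=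
      Cong.mul (Cong.refl _ _) (hd y)
    rw [e1 n (by omega), e2 n (by omega)]

theorem lamP_deriv (p : ℕ) (hp : 1 ≤ p) (hinv : ∀ n : ℕ, 0 < n → n < p → (n : K) ≠ 0) (z : K[X]) :
    (1 + z) * derivative (lamP p z) = (1 - (-z) ^ (p - 1)) * derivative z := by
  have h : derivative (lamP p z) = (∑ i ∈ Finset.range (p - 1), (-z) ^ i) * derivative z := by
    rw [lamP, derivative_sum, Finset.sum_mul, ← Finset.Ico_add_one_right_eq_Icc,
      Finset.sum_Ico_eq_sum_range]
    refine Finset.sum_congr (by congr 1) fun i hi => ?_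
    have hi' := Finset.mem_range.1 hi
    have h1 : ((1 + i : ℕ) : K) ≠ 0 := hinv _ (by omega) (by omega)
    have h2 : (C (((1 + i : ℕ) : K)⁻¹) : K[X]) * ((1 + i : ℕ) : K[X]) = 1 := by
      rw [← C_eq_natCast, ← C_mul, inv_mul_cancel₀ h1, C_1]
    rw [derivative_C_mul, derivative_pow, C_mul, C_pow, C_neg, C_1, Nat.add_sub_cancel_left, 
      neg_pow z]
    calc _ = (C (((1 + i : ℕ) : K)⁻¹) * ((1 + i : ℕ) : K[X])) * ((-1) ^ i * z ^ i * derivative z) := by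
            rw [C_eq_natCast]; ring
      _ = _ := by rw [h2, one_mul]
  rw [h, ← mul_assoc]
  congr 1
  have := mul_neg_geom_sum (-z) (p - 1)
  rw [← this]; ring

theorem lamP_coeff (p : ℕ) (hp : 1 ≤ p) (hinv : ∀ n : ℕ, 0 < n → n < p → (n : K) ≠ 0) (D : K → K)
    (hadd : ∀ x y, D (x + y) = D x + D y) (hmul : ∀ x y, D (x * y) = D x * y + x * D y)
    (x : K) (hx : x ≠ 0) :
    Cong p (lamP p (C x⁻¹ * TT p D x - 1))
      (∑ i ∈ Finset.Icc 1 (p - 1), C (D^[i - 1] (D x / x) / (Nat.factorial i : K)) * X ^ i) := by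
  set z := C x⁻¹ * TT p D x - 1 with hz
  have hxz : TT p D x = C x * (1 + z) := by
    rw [hz, add_sub_cancel, ← mul_assoc, ← C_mul, mul_inv_cancel₀ hx, C_1, one_mul]
  have hz0 : z.coeff 0 = 0 := by
    simp [hz, coeff_TT, hx]
    rw [if_pos (by omega), sub_self]
  have hXz : X ∣ z := X_dvd_iff.2 hz0
  -- main congruence
  have key : Cong (p - 1) (derivative (lamP p z)) (TT p D (D x / x)) := by
    have e1 : Cong (p - 1) (TT p D x * derivative (lamP p z)) (TT p D x * TT p D (D x / x)) := by
      intro n hn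
      have := TT_mul p hinv D hadd hmul x (D x / x) n (by omega)
      rw [← this, mul_div_cancel₀ _ hx, ← derivative_TT p hinv D x n hn, hxz, mul_assoc,
        lamP_deriv p hp hinv, derivative_C_mul, derivative_add, derivative_one, zero_add,
        coeff_C_mul, coeff_C_mul, sub_mul, one_mul, coeff_sub]
      have hdvd : X ^ (p - 1) ∣ (-z) ^ (p - 1) * derivative z :=
        (pow_dvd_pow_of_dvd ((dvd_neg).2 hXz) _).mul_right _
      rw [X_pow_dvd_iff.1 hdvd n hn, sub_zero]
    have hdiff : X ^ (p - 1) ∣ TT p D x * (derivative (lamP p z) - TT p D (D x / x)) := by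
      rw [X_pow_dvd_iff]
      intro n hn
      rw [mul_sub, coeff_sub, e1 n hn, sub_self]
    have hcop : IsCoprime (X ^ (p - 1) : K[X]) (TT p D x) := by
      refine IsCoprime.pow_left ?_
      rw [(irreducible_X).coprime_iff_not_dvd, X_dvd_iff]
      simp [coeff_TT, hx]
      omega
    have := hcop.dvd_of_dvd_mul_left hdiff
    intro n hn
    have h2 := X_pow_dvd_iff.1 this n hn
    rwa [coeff_sub, sub_eq_zero] at h2
  intro n hn
  have hr : (∑ i ∈ Finset.Icc 1 (p - 1),
      C (D^[i - 1] (D x / x) / (Nat.factorial i : K)) * X ^ i).coeff n =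
      if 1 ≤ n then D^[n - 1] (D x / x) / (Nat.factorial n : K) else 0 := by
    simp only [finsetSum_coeff, coeff_C_mul, coeff_X_pow, mul_ite, mul_one, mul_zero,
      Finset.sum_ite_eq, Finset.mem_Icc]
    congr 1
    simp; omega
  rw [hr]
  rcases n with _ | n
  · simp only [lamP, finsetSum_coeff]
    refine (Finset.sum_eq_zero fun i hi => ?_).trans (by simp)
    have := (Finset.mem_Icc.1 hi).1
    rw [coeff_C_mul, coeff_zero_eq_eval_zero, eval_pow, ← coeff_zero_eq_eval_zero, hz0,
      zero_pow (by omega), mul_zero]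
  · have h1 : ((n + 1 : ℕ) : K) ≠ 0 := hinv _ (by omega) (by omega)
    have := key n (by omega)
    rw [coeff_derivative, coeff_TT, if_pos (by omega), ← Nat.cast_succ] at this
    rw [if_pos (by omega), Nat.add_sub_cancel, Nat.factorial_succ, Nat.cast_mul, mul_comm,
      ← div_div, ← this]
    rw [mul_div_cancel_right₀ _ h1]

end Algebra
section OrdGe

theorem ordGe_iff_orderTop {x : LaurentSeries F} {N : ℤ} :
    ordGe x N ↔ (N : WithTop ℤ) ≤ HahnSeries.addVal ℤ F x := by
  unfold ordGe
  by_cases h : x = 0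
  · simp [h]
  · rw [HahnSeries.addVal_apply_of_ne h]
    simp [h]

theorem ordGe_iff {x : LaurentSeries F} {N : ℤ} : ordGe x N ↔ ∀ j < N, x.coeff j = 0 := by
  rw [ordGe_iff_orderTop, HahnSeries.addVal_apply, HahnSeries.le_orderTop_iff_forall]
  simp

theorem ordGe.add {x y : LaurentSeries F} {N : ℤ} (hx : ordGe x N) (hy : ordGe y N) :
    ordGe (x + y) N := by
  rw [ordGe_iff] at *
  intro j hj
  simp [hx j hj, hy j hj]

theorem ordGe.neg {x : LaurentSeries F} {N : ℤ} (hx : ordGe x N) : ordGe (-x) N := by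
  rw [ordGe_iff] at *
  intro j hj
  simp [hx j hj]

theorem ordGe.sub {x y : LaurentSeries F} {N : ℤ} (hx : ordGe x N) (hy : ordGe y N) :
    ordGe (x - y) N := by
  rw [sub_eq_add_neg]; exact hx.add hy.neg

theorem ordGe.mono {x : LaurentSeries F} {N M : ℤ} (hx : ordGe x N) (h : M ≤ N) :
    ordGe x M := by
  rw [ordGe_iff] at *
  exact fun j hj => hx j (by omega)

theorem ordGe_zero (N : ℤ) : ordGe (0 : LaurentSeries F) N := Or.inl rfl

theorem ordGe.mul {x y : LaurentSeries F} {N M : ℤ} (hx : ordGe x N) (hy : ordGe y M) :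
    ordGe (x * y) (N + M) := by
  rw [ordGe_iff_orderTop] at *
  rw [AddValuation.map_mul, WithTop.coe_add]
  exact add_le_add hx hy

theorem ordGe_single (n : ℤ) (c : F) : ordGe (HahnSeries.single n c) n := by
  rw [ordGe_iff]
  intro j hj
  exact HahnSeries.coeff_single_of_ne (by omega)

theorem ordGe_one : ordGe (1 : LaurentSeries F) 0 := ordGe_single 0 1

theorem ordGe.pow {x : LaurentSeries F} {N : ℤ} (hx : ordGe x N) (n : ℕ) :
    ordGe (x ^ n) (n * N) := by
  induction n with
  | zero => simpa using ordGe_one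
  | succ n ih =>
    rw [pow_succ]
    exact (ih.mul hx).mono (by push_cast; linarith)

theorem ordGe_sum {ι : Type*} (s : Finset ι) (f : ι → LaurentSeries F) (N : ℤ)
    (h : ∀ i ∈ s, ordGe (f i) N) : ordGe (∑ i ∈ s, f i) N := by
  classical
  induction s using Finset.induction_on with
  | empty => exact ordGe_zero N
  | insert a s ha ih =>
    rw [Finset.sum_insert ha]
    exact (h _ (by simp)).add (ih fun i hi => h i (by simp [hi]))

theorem ordGe_inv_natCast (n : ℕ) : ordGe ((n : LaurentSeries F)⁻¹) 0 := by
  have : (n : LaurentSeries F)⁻¹ = HahnSeries.C ((n : F)⁻¹) := by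
    rw [map_inv₀, map_natCast]
  rw [this]
  exact ordGe_single 0 _

theorem ordGe_neg_one_pow (n : ℕ) : ordGe ((-1 : LaurentSeries F) ^ n) 0 := by
  simpa using (ordGe_one (F := F)).neg.pow n

theorem ordGe_pow_sub {a b : LaurentSeries F} {N : ℤ} (ha : ordGe a 0) (hb : ordGe b 0)
    (h : ordGe (a - b) N) (n : ℕ) : ordGe (a ^ n - b ^ n) N := by
  induction n with
  | zero => simpa using ordGe_zero N
  | succ n ih =>
    have : a ^ (n + 1) - b ^ (n + 1) = (a ^ n - b ^ n) * a + b ^ n * (a - b) := by ring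
    rw [this]
    exact ((ih.mul ha).mono (by simp)).add (((hb.pow n).mul h).mono (by simp))

theorem lam_sub (p : ℕ) {a b : LaurentSeries F} {N : ℤ} (ha : ordGe a 0) (hb : ordGe b 0)
    (h : ordGe (a - b) N) : ordGe (lam p a - lam p b) N := by
  unfold lam
  rw [← Finset.sum_sub_distrib]
  refine ordGe_sum _ _ _ fun i _ => ?_
  rw [← mul_sub]
  exact (((ordGe_neg_one_pow _).mul (ordGe_inv_natCast _)).mul
    (ordGe_pow_sub ha hb h i)).mono (by simp)

theorem tt_ne : (tt : LaurentSeries F) ≠ 0 := HahnSeries.single_ne_zero one_ne_zero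

theorem ordGe_tt : ordGe (tt : LaurentSeries F) 1 := ordGe_single 1 1

theorem tt_inv : (tt : LaurentSeries F)⁻¹ = HahnSeries.single (-1) 1 := by
  refine inv_eq_of_mul_eq_one_right ?_
  simp [tt, HahnSeries.single_mul_single]

theorem lsDeriv_add (x y : LaurentSeries F) : lsDeriv (x + y) = lsDeriv x + lsDeriv y := by
  ext j
  simp only [lsDeriv, HahnSeries.coeff_add, smul_add]

theorem coeff_tt_mul_lsDeriv (x : LaurentSeries F) (j : ℤ) :
    (tt * lsDeriv x).coeff j = j • x.coeff j := by
  rw [tt, HahnSeries.coeff_single_mul]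
  simp [lsDeriv]

theorem lsDeriv_mul (x y : LaurentSeries F) :
    lsDeriv (x * y) = lsDeriv x * y + x * lsDeriv y := by
  have hs : ∀ z : LaurentSeries F, (tt * lsDeriv z).support ⊆ z.support := by
    intro z j hj
    rw [HahnSeries.mem_support] at *
    rw [coeff_tt_mul_lsDeriv] at hj
    intro h0
    simp [h0] at hj
  refine mul_left_cancel₀ (tt_ne (F := F)) ?_
  have e : tt * (lsDeriv x * y + x * lsDeriv y) = (tt * lsDeriv x) * y + x * (tt * lsDeriv y) := by
    ring
  rw [e]
  ext j
  rw [coeff_tt_mul_lsDeriv, HahnSeries.coeff_add, HahnSeries.coeff_mul,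
    HahnSeries.coeff_mul_left' x.isPWO_support (hs x),
    HahnSeries.coeff_mul_right' y.isPWO_support (hs y), Finset.smul_sum, ← Finset.sum_add_distrib]
  refine Finset.sum_congr rfl fun ij hij => ?_
  have h := (Finset.mem_antidiagonal.1 hij).2.2
  rw [coeff_tt_mul_lsDeriv, coeff_tt_mul_lsDeriv, ← h]
  simp only [zsmul_eq_mul]
  push_cast
  ring

theorem ordGe_lsDeriv {x : LaurentSeries F} {N : ℤ} (hx : ordGe x N) :
    ordGe (lsDeriv x) (N - 1) := by
  rw [ordGe_iff] at *
  intro j hj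
  simp [lsDeriv, hx (j + 1) (by omega)]

theorem ordGe_lsDeriv_iter {x : LaurentSeries F} {N : ℤ} (hx : ordGe x N) (i : ℕ) :
    ordGe (lsDeriv^[i] x) (N - i) := by
  induction i with
  | zero => simpa using hx
  | succ i ih =>
    rw [Function.iterate_succ_apply']
    exact (ordGe_lsDeriv ih).mono (by push_cast; linarith)

theorem lsDeriv_const (c : F) : lsDeriv (HahnSeries.single 0 c) = 0 := by
  ext j
  simp only [lsDeriv, HahnSeries.coeff_zero]
  by_cases h : j + 1 = 0
  · simp [h]
  · rw [HahnSeries.coeff_single_of_ne h, smul_zero]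

theorem lsDeriv_iter_const (c : F) (n : ℕ) (hn : 1 ≤ n) :
    lsDeriv^[n] (HahnSeries.single 0 c) = 0 := by
  induction n, hn using Nat.le_induction with
  | base => exact lsDeriv_const c
  | succ n hn ih =>
    rw [Function.iterate_succ_apply', ih]
    simpa using lsDeriv_const (0 : F)

theorem lsDeriv_tt : lsDeriv (tt : LaurentSeries F) = 1 := by
  ext j
  simp only [lsDeriv, tt]
  by_cases h : j = 0
  · simp [h]
  · rw [HahnSeries.coeff_single_of_ne (by omega), smul_zero, HahnSeries.coeff_one, if_neg h]

end OrdGe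

section Weighted

open Polynomial

/-- `f(tW)` has coefficients of order at least `a`. -/
def Wt (f : (LaurentSeries F)[X]) (a : ℤ) : Prop := ∀ i : ℕ, ordGe (f.coeff i) (a - i)

theorem Wt.mul {f g : (LaurentSeries F)[X]} {a b : ℤ} (hf : Wt f a) (hg : Wt g b) :
    Wt (f * g) (a + b) := by
  intro n
  rw [coeff_mul]
  refine ordGe_sum _ _ _ fun ij hij => ?_
  have := Finset.HasAntidiagonal.mem_antidiagonal.1 hij
  exact ((hf ij.1).mul (hg ij.2)).mono (by rw [← this]; push_cast; linarith)

theorem Wt.add {f g : (LaurentSeries F)[X]} {a : ℤ} (hf : Wt f a) (hg : Wt g a) :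
    Wt (f + g) a := by
  intro n
  rw [coeff_add]
  exact (hf n).add (hg n)

theorem Wt.sub {f g : (LaurentSeries F)[X]} {a : ℤ} (hf : Wt f a) (hg : Wt g a) :
    Wt (f - g) a := by
  intro n
  rw [coeff_sub]
  exact (hf n).sub (hg n)

theorem Wt_C {c : LaurentSeries F} {a : ℤ} (h : ordGe c a) : Wt (C c) a := by
  intro n
  rw [coeff_C]
  split_ifs with h0
  · exact h.mono (by simp)
  · exact ordGe_zero _

theorem Wt_sum {ι : Type*} (s : Finset ι) (f : ι → (LaurentSeries F)[X]) (a : ℤ)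
    (h : ∀ i ∈ s, Wt (f i) a) : Wt (∑ i ∈ s, f i) a := by
  intro n
  rw [finsetSum_coeff]
  exact ordGe_sum _ _ _ fun i hi => h i hi n

theorem Wt.pow {f : (LaurentSeries F)[X]} (hf : Wt f 0) (n : ℕ) : Wt (f ^ n) 0 := by
  induction n with
  | zero => simpa using Wt_C (ordGe_one (F := F))
  | succ n ih => simpa [pow_succ] using ih.mul hf

theorem Wt_X : Wt (X : (LaurentSeries F)[X]) 1 := by
  intro n
  rw [coeff_X]
  split_ifs with h
  · subst h; simpa using ordGe_one
  · exact ordGe_zero _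

theorem Wt_TT (p : ℕ) {x : LaurentSeries F} {a : ℤ} (hx : ordGe x a) : Wt (TT p lsDeriv x) a := by
  intro n
  rw [coeff_TT]
  split_ifs
  · rw [div_eq_mul_inv]
    exact ((ordGe_lsDeriv_iter hx n).mul (ordGe_inv_natCast _)).mono (by simp)
  · exact ordGe_zero _

theorem Wt_lamP (p : ℕ) {z : (LaurentSeries F)[X]} (hz : Wt z 0) : Wt (lamP p z) 0 := by
  refine Wt_sum _ _ _ fun i _ => ?_
  simpa using (Wt_C ((ordGe_neg_one_pow (i + 1)).mul (ordGe_inv_natCast i))).mul (hz.pow i)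

theorem Wt_eval {E : Type*} [Field E] (v : LaurentSeries F →+* LaurentSeries E)
    (hv : ∀ x N, ordGe x N → ordGe (v x) N) (e : LaurentSeries E) (r : ℕ)
    (he : ordGe e (1 + r)) {f : (LaurentSeries F)[X]} {a : ℤ} (hf : Wt f a) (q : ℕ)
    (h0 : ∀ i < q, f.coeff i = 0) : ordGe (f.eval₂ v e) (a + q * r) := by
  rw [eval₂_eq_sum, Polynomial.sum]
  refine ordGe_sum _ _ _ fun i hi => ?_
  have hqi : q ≤ i := by
    by_contra h
    exact (mem_support_iff.1 hi) (h0 i (by omega))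
  refine ((hv _ _ (hf i)).mul (he.pow i)).mono ?_
  have : (q : ℤ) * r ≤ i * r := by gcongr
  linarith

end Weighted
section Taylor

open Polynomial

theorem TT_const (p : ℕ) (hp : 1 ≤ p) (c : F) :
    TT p lsDeriv (HahnSeries.single 0 c) = C (HahnSeries.single 0 c) := by
  ext1 n
  rw [coeff_TT, coeff_C]
  rcases n with _ | n
  · simp; omega
  · simp [lsDeriv_iter_const c (n + 1) (by omega)]

theorem TT_tt (p : ℕ) (hp : 2 ≤ p) : TT p lsDeriv (tt : LaurentSeries F) = C tt + X := by
  ext1 n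
  rw [coeff_TT, coeff_add, coeff_C, coeff_X]
  rcases n with _ | _ | n
  · simp; omega
  · simp [lsDeriv_tt]; omega
  · have h1 : (1 : LaurentSeries F) = HahnSeries.single 0 1 := rfl
    rw [Function.iterate_succ_apply, lsDeriv_tt, h1, lsDeriv_iter_const _ _ (by omega)]
    simp

variable {E : Type*} [Field E]

/-- `u` agrees with the truncated Taylor expansion at `x`, of order at least `a`. -/
def Good (p r : ℕ) (u v : LaurentSeries F →+* LaurentSeries E) (e : LaurentSeries E)
    (x : LaurentSeries F) (a : ℤ) : Prop :=
  ordGe x a ∧ ordGe (u x - (TT p lsDeriv x).eval₂ v e) (a + p * r)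

theorem eval_TT_ord {p r : ℕ} {v : LaurentSeries F →+* LaurentSeries E} {e : LaurentSeries E}
    (hv : ∀ x N, ordGe x N → ordGe (v x) N) (he : ordGe e (1 + r))
    {x : LaurentSeries F} {a : ℤ} (hx : ordGe x a) :
    ordGe ((TT p lsDeriv x).eval₂ v e) a := by
  simpa using Wt_eval v hv e r he (Wt_TT p hx) 0 (by simp)

theorem eval_TT_mul {p r : ℕ} (hinv : ∀ n : ℕ, 0 < n → n < p → (n : LaurentSeries F) ≠ 0)
    {v : LaurentSeries F →+* LaurentSeries E} {e : LaurentSeries E}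
    (hv : ∀ x N, ordGe x N → ordGe (v x) N) (he : ordGe e (1 + r))
    {x y : LaurentSeries F} {a b : ℤ} (hx : ordGe x a) (hy : ordGe y b) :
    ordGe ((TT p lsDeriv (x * y)).eval₂ v e -
      (TT p lsDeriv x).eval₂ v e * (TT p lsDeriv y).eval₂ v e) (a + b + p * r) := by
  rw [← eval₂_mul, ← eval₂_sub]
  refine Wt_eval v hv e r he ((Wt_TT p (hx.mul hy)).sub ((Wt_TT p hx).mul (Wt_TT p hy))) p ?_
  intro i hi
  rw [coeff_sub, TT_mul p hinv lsDeriv lsDeriv_add lsDeriv_mul x y i hi, sub_self]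

theorem Good.ord {p r : ℕ} {u v : LaurentSeries F →+* LaurentSeries E} {e : LaurentSeries E}
    (hv : ∀ x N, ordGe x N → ordGe (v x) N) (he : ordGe e (1 + r))
    {x : LaurentSeries F} {a : ℤ} (h : Good p r u v e x a) : ordGe (u x) a := by
  have := (h.2.mono (M := a) (by have : (0 : ℤ) ≤ p * r := by positivity
                                 linarith)).add (eval_TT_ord hv he (p := p) h.1)
  simpa using this

theorem Good.mul {p r : ℕ} (hinv : ∀ n : ℕ, 0 < n → n < p → (n : LaurentSeries F) ≠ 0)
    {u v : LaurentSeries F →+* LaurentSeries E} {e : LaurentSeries E}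
    (hv : ∀ x N, ordGe x N → ordGe (v x) N) (he : ordGe e (1 + r))
    {x y : LaurentSeries F} {a b : ℤ} (hx : Good p r u v e x a) (hy : Good p r u v e y b) :
    Good p r u v e (x * y) (a + b) := by
  refine ⟨hx.1.mul hy.1, ?_⟩
  have h1 := eval_TT_mul hinv hv he hx.1 hy.1
  have h2 := (hx.2.mul (hy.ord hv he)).mono (M := a + b + p * r) (by linarith)
  have h3 := ((eval_TT_ord hv he (p := p) hx.1).mul hy.2).mono (M := a + b + p * r) (by linarith)
  convert (h2.add h3).sub h1 using 1
  rw [map_mul]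
  ring

theorem Good.pow {p r : ℕ} (hinv : ∀ n : ℕ, 0 < n → n < p → (n : LaurentSeries F) ≠ 0)
    {u v : LaurentSeries F →+* LaurentSeries E} {e : LaurentSeries E}
    (hv : ∀ x N, ordGe x N → ordGe (v x) N) (he : ordGe e (1 + r))
    (h1 : Good p r u v e 1 0)
    {x : LaurentSeries F} {a : ℤ} (hx : Good p r u v e x a) (n : ℕ) :
    Good p r u v e (x ^ n) (n * a) := by
  induction n with
  | zero => simpa using h1
  | succ n ih =>
    rw [pow_succ]
    have := ih.mul hinv hv he hx
    convert this using 1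
    push_cast; ring

theorem single_eq (n : ℤ) (c : F) :
    ∃ m : ℕ, (n = m ∧ HahnSeries.single n c = HahnSeries.single 0 c * tt ^ m) ∨
      (n = -m ∧ HahnSeries.single n c = HahnSeries.single 0 c * (tt⁻¹) ^ m) := by
  obtain ⟨m, rfl | rfl⟩ := n.eq_nat_or_neg
  · exact ⟨m, Or.inl ⟨rfl, by simp [tt, HahnSeries.single_pow]⟩⟩
  · exact ⟨m, Or.inr ⟨rfl, by rw [tt_inv]; simp [HahnSeries.single_pow]⟩⟩

theorem good_all {p r : ℕ} (hp : 2 ≤ p) (hr : 1 ≤ r)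
    (hinv : ∀ n : ℕ, 0 < n → n < p → (n : LaurentSeries F) ≠ 0)
    {u v : LaurentSeries F →+* LaurentSeries E} {w : LaurentSeries E}
    (hv : ∀ x N, ordGe x N → ordGe (v x) N) (hw : ordGe w r)
    (hvt : v tt = tt)
    (huc : ∀ c : F, u (HahnSeries.single 0 c) = v (HahnSeries.single 0 c))
    (hut : u tt = tt * (1 + w))
    (hu_cont : ∀ N : ℤ, ∃ M : ℤ, ∀ x : LaurentSeries F, ordGe x M → ordGe (u x) N)
    {x : LaurentSeries F} {a : ℤ} (hx : ordGe x a) : Good p r u v (tt * w) x a := by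
  have he : ordGe (tt * w) (1 + r) := ordGe_tt.mul hw
  have hc : ∀ c, Good p r u v (tt * w) (HahnSeries.single 0 c) 0 := by
    intro c
    refine ⟨ordGe_single 0 c, ?_⟩
    rw [TT_const p (by omega), eval₂_C, huc, sub_self]
    exact ordGe_zero _
  have h1 : Good p r u v (tt * w) 1 0 := hc 1
  have hT : Good p r u v (tt * w) tt 1 := by
    refine ⟨ordGe_tt, ?_⟩
    rw [TT_tt p hp, eval₂_add, eval₂_C, eval₂_X, hut, hvt]
    convert ordGe_zero _ using 1
    ring
  have hw1 : HahnSeries.addVal ℤ E (1 + w) = 0 := by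
    have : HahnSeries.addVal ℤ E (1 : LaurentSeries E) < HahnSeries.addVal ℤ E w := by
      rw [AddValuation.map_one]
      have := ordGe_iff_orderTop.1 hw
      refine lt_of_lt_of_le ?_ this
      exact_mod_cast hr
    rw [add_comm, AddValuation.map_add_eq_of_lt_right _ this, AddValuation.map_one]
  have hne : (1 + w) ≠ 0 := by
    intro h
    rw [h, AddValuation.map_zero] at hw1
    exact absurd hw1 (by simp)
  have hw2 : ordGe (1 + w)⁻¹ 0 := by
    rw [ordGe_iff_orderTop]
    have : HahnSeries.addVal ℤ E ((1 + w) * (1 + w)⁻¹) = 0 := by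
      rw [mul_inv_cancel₀ hne, AddValuation.map_one]
    rw [AddValuation.map_mul, hw1, zero_add] at this
    rw [this]; rfl
  have hui : ordGe (u tt⁻¹) (-1) := by
    rw [map_inv₀, hut, mul_inv, tt_inv]
    exact ((ordGe_single (-1) 1).mul hw2).mono (by simp)
  have htinv : ordGe (tt⁻¹ : LaurentSeries F) (-1) := by
    rw [tt_inv]; exact ordGe_single _ _
  have hTi : Good p r u v (tt * w) tt⁻¹ (-1) := by
    refine ⟨htinv, ?_⟩
    have e1 := eval_TT_mul hinv hv he ordGe_tt htinv
    rw [mul_inv_cancel₀ tt_ne] at e1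
    have e2 := h1.2
    have e3 := hT.2.mul (eval_TT_ord (p := p) hv he htinv)
    have hprod : u tt * u tt⁻¹ = 1 := by rw [← map_mul, mul_inv_cancel₀ tt_ne, map_one]
    rw [map_one] at e2
    set A := eval₂ v (tt * w) (TT p lsDeriv tt)
    set B := eval₂ v (tt * w) (TT p lsDeriv tt⁻¹)
    set I := eval₂ v (tt * w) (TT p lsDeriv 1)
    have e4 : ordGe (1 - u tt * B) (p * r) := by
      have := ((e2.mono (M := (p * r : ℤ)) (by simp)).add (e1.mono (M := (p * r : ℤ)) (by simp))).sub
        (e3.mono (M := (p * r : ℤ)) (by linarith))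
      convert this using 1
      ring
    convert hui.mul e4 using 1
    linear_combination B * hprod
  have hmono : ∀ (n : ℤ) (c : F), Good p r u v (tt * w) (HahnSeries.single n c) n := by
    intro n c
    obtain ⟨m, ⟨h, h'⟩ | ⟨h, h'⟩⟩ := single_eq n c
    · rw [h']
      convert (hc c).mul hinv hv he (Good.pow hinv hv he h1 hT m) using 1
      rw [h]; ring
    · rw [h']
      convert (hc c).mul hinv hv he (Good.pow hinv hv he h1 hTi m) using 1
      rw [h]; ring
  refine ⟨hx, ?_⟩
  obtain ⟨M, hM⟩ := hu_cont (a + p * r)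
  have key : ∀ (d : ℕ) (b : ℤ) (y : LaurentSeries F), a ≤ b → max M (a + p * r) ≤ b + d → ordGe y b →
      ordGe (u y - (TT p lsDeriv y).eval₂ v (tt * w)) (a + p * r) := by
    intro d
    induction d with
    | zero =>
      intro b y _ hb hy
      have := le_max_left M (a + p * r)
      have := le_max_right M (a + p * r)
      simp only [Nat.cast_zero, add_zero] at hb
      exact (hM y (hy.mono (by omega))).sub ((eval_TT_ord hv he hy).mono (by omega))
    | succ d ih =>
      intro b y hab hb hy
      have hz : ordGe (y - HahnSeries.single b (y.coeff b)) (b + 1) := by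
        rw [ordGe_iff] at *
        intro j hj
        rw [HahnSeries.coeff_sub]
        by_cases h : j = b
        · subst h; simp
        · rw [HahnSeries.coeff_single_of_ne h, hy j (by omega), sub_zero]
      have e1 := ih (b + 1) _ (by omega) (by push_cast at hb; omega) hz
      have e2 := (hmono b (y.coeff b)).2.mono (M := a + p * r) (by omega)
      have e3 := e1.add e2
      have e4 : TT p lsDeriv y = TT p lsDeriv (y - HahnSeries.single b (y.coeff b)) +
          TT p lsDeriv (HahnSeries.single b (y.coeff b)) := by
        rw [← TT_add p lsDeriv lsDeriv_add, sub_add_cancel]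
      rw [e4, eval₂_add]
      convert e3 using 1
      rw [map_sub]; ring
  exact key (max M (a + p * r) - a).toNat a x le_rfl (by omega) hx

end Taylor

/-- For every `x ∈ K^×`, setting `y = x'/x`, the element
`λ(u(x)/v(x) − 1) − Σ_{i=1}^{p−1} v(t^i·y^{(i−1)}/i!)·(t^r·θ)^i` of `L` lies in `t^{pr}·R_L`. -/
theorem statement7 (p : ℕ) (hp : p.Prime) (hp2 : 2 < p)
    (k : Type*) [Field k] [PerfectField k] [CharP k p]
    (r : ℕ) (hr : 1 ≤ r)
    (u v : LaurentSeries k →+* LaurentSeries (RatFunc k))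
    (hv : ∀ (x : LaurentSeries k) (j : ℤ),
      (v x).coeff j = algebraMap k (RatFunc k) (x.coeff j))
    (hu_alg : ∀ c : k,
      u (HahnSeries.single 0 c) = HahnSeries.single 0 (algebraMap k (RatFunc k) c))
    (hu_t : u tt = tt * (1 + tt ^ r * θθ k))
    (hu_cont : ∀ N : ℤ, ∃ M : ℤ, ∀ x : LaurentSeries k, ordGe x M → ordGe (u x) N)
    (x : LaurentSeries k) (hx : x ≠ 0) :
    ordGe
      (lam p (u x / v x - 1) -
        ∑ i ∈ Finset.Icc 1 (p - 1),
          v (tt ^ i * lsDeriv^[i - 1] (lsDeriv x / x) / (Nat.factorial i : LaurentSeries k)) *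
            ((tt : LaurentSeries (RatFunc k)) ^ r * θθ k) ^ i)
      ((p : ℤ) * (r : ℤ)) := by
  have hvo : ∀ x N, ordGe x N → ordGe (v x) N := by
    intro x N h
    rw [ordGe_iff] at *
    intro j hj
    rw [hv, h j hj, map_zero]
  have hvs : ∀ (n : ℤ) (c : k), v (HahnSeries.single n c) =
      HahnSeries.single n (algebraMap k (RatFunc k) c) := by
    intro n c
    ext j
    rw [hv]
    by_cases h : j = n
    · subst h; simp
    · rw [HahnSeries.coeff_single_of_ne h, HahnSeries.coeff_single_of_ne h, map_zero]
  have hvt : v tt = tt := by rw [tt, hvs, map_one]; rfl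
  have hinv : ∀ n : ℕ, 0 < n → n < p → (n : LaurentSeries k) ≠ 0 := by
    intro n h0 hn h
    have h2 : HahnSeries.C (Γ := ℤ) (n : k) = 0 := by rw [map_natCast]; exact h
    have h3 : (n : k) = 0 := by
      rw [← map_zero (HahnSeries.C (Γ := ℤ) (R := k))] at h2
      exact HahnSeries.C_injective h2
    rw [CharP.cast_eq_zero_iff k p] at h3
    exact absurd (Nat.le_of_dvd h0 h3) (by omega)
  set w : LaurentSeries (RatFunc k) := tt ^ r * θθ k with hwdef
  have hw : ordGe w r :=
    (((ordGe_tt (F := RatFunc k)).pow r).mul (ordGe_single 0 RatFunc.X)).mono (by simp)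
  have he : ordGe (tt * w) (1 + r) := ordGe_tt.mul hw
  have hxm : ordGe x x.order := Or.inr le_rfl
  have hxi : ordGe x⁻¹ (-x.order) := by
    refine Or.inr (le_of_eq ?_)
    have := HahnSeries.order_mul hx (inv_ne_zero hx)
    rw [mul_inv_cancel₀ hx, HahnSeries.order_one] at this
    omega
  have hG : Good p r u v (tt * w) x x.order :=
    good_all hp.two_le hr hinv hvo hw hvt (fun c => by rw [hu_alg, hvs]) hu_t hu_cont hxm
  set z : Polynomial (LaurentSeries k) := Polynomial.C x⁻¹ * TT p lsDeriv x - 1 with hzdef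
  have hWz : Wt z 0 := by
    refine Wt.sub ?_ (by simpa using Wt_C (ordGe_one (F := k)))
    simpa using (Wt_C hxi).mul (Wt_TT p hxm)
  have hlamev : (lamP p z).eval₂ v (tt * w) = lam p (z.eval₂ v (tt * w)) := by
    rw [lamP, lam, Polynomial.eval₂_finsetSum]
    refine Finset.sum_congr rfl fun i _ => ?_
    rw [Polynomial.eval₂_mul, Polynomial.eval₂_C, Polynomial.eval₂_pow, map_mul, map_pow, map_neg,
      map_one, map_inv₀, map_natCast]
  have hze : z.eval₂ v (tt * w) = v x⁻¹ * (TT p lsDeriv x).eval₂ v (tt * w) - 1 := by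
    rw [hzdef, Polynomial.eval₂_sub, Polynomial.eval₂_mul, Polynomial.eval₂_C, Polynomial.eval₂_one]
  have hb : ordGe (z.eval₂ v (tt * w)) 0 := by
    simpa using Wt_eval v hvo _ r he hWz 0 (by simp)
  have hab : ordGe (u x / v x - 1 - z.eval₂ v (tt * w)) (p * r) := by
    convert (hG.2.mul (hvo _ _ hxi)).mono (M := (p * r : ℤ)) (by linarith) using 1
    rw [hze, map_inv₀]
    ring
  have ha : ordGe (u x / v x - 1) 0 := by
    have := (hab.mono (M := 0) (by positivity)).add hb
    simpa using this
  have h1 := lam_sub p ha hb hab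
  set Q : Polynomial (LaurentSeries k) := ∑ i ∈ Finset.Icc 1 (p - 1),
    Polynomial.C (lsDeriv^[i - 1] (lsDeriv x / x) / (Nat.factorial i : LaurentSeries k)) *
      Polynomial.X ^ i with hQ
  have hy : ordGe (lsDeriv x / x) (-1) := by
    rw [div_eq_mul_inv]
    exact ((ordGe_lsDeriv hxm).mul hxi).mono (by linarith)
  have hWQ : Wt Q 0 := by
    refine Wt_sum _ _ _ fun i hi n => ?_
    have hi1 := (Finset.mem_Icc.1 hi).1
    rw [Polynomial.coeff_C_mul, Polynomial.coeff_X_pow]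
    split_ifs with h
    · rw [mul_one, div_eq_mul_inv]
      exact ((ordGe_lsDeriv_iter hy (i - 1)).mul (ordGe_inv_natCast _)).mono (by omega)
    · rw [mul_zero]; exact ordGe_zero _
  have h2 : ordGe ((lamP p z - Q).eval₂ v (tt * w)) (p * r) := by
    have := Wt_eval v hvo _ r he ((Wt_lamP p hWz).sub hWQ) p (fun i hi => by
      rw [Polynomial.coeff_sub,
        lamP_coeff p hp.one_le hinv lsDeriv lsDeriv_add lsDeriv_mul x hx i hi, sub_self])
    simpa using this
  have hQe : Q.eval₂ v (tt * w) = ∑ i ∈ Finset.Icc 1 (p - 1),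
      v (tt ^ i * lsDeriv^[i - 1] (lsDeriv x / x) / (Nat.factorial i : LaurentSeries k)) *
        w ^ i := by
    rw [hQ, Polynomial.eval₂_finsetSum]
    refine Finset.sum_congr rfl fun i _ => ?_
    rw [Polynomial.eval₂_mul, Polynomial.eval₂_C, Polynomial.eval₂_pow, Polynomial.eval₂_X,
      mul_div_assoc, map_mul, map_pow, hvt, mul_pow]
    ring
  rw [Polynomial.eval₂_sub, hlamev, hQe] at h2
  convert h1.add h2 using 1
  ring

end LFT
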